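/- arXiv:2210.04322 — 6 statements merged into one kernel-verified Lean document; each statement's English description precedes it below -/
import Mathlib

section
/- For every natural number n ≥ 1, if C_{2n} = Σ_{j=1}^{⌊n/5⌋} C(2n, n+5j), then 5·(C_{2n} + C(2n−1, n)) = 2^{2n−1} + L_{2n}. -/
/-- The Lucas numbers: `L 0 = 2`, `L 1 = 1`, `L (n+2) = L (n+1) + L n`. -/
def lucas : ℕ → ℕ
  | 0 => 2
  | 1 => 1
  | n + 2 => lucas (n + 1) + lucas n

/-- The sum of the binomial coefficients `n.choose k` over `k` congruent to `r` modulo `5`. -/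
def residueChooseSum (n : ℕ) (r : ZMod 5) : ℕ :=
  ∑ k ∈ Finset.range (n + 1), n.choose k * if (k : ZMod 5) = r then 1 else 0

theorem residueChooseSum_succ (n : ℕ) (r : ZMod 5) :
    residueChooseSum (n + 1) r = residueChooseSum n r + residueChooseSum n (r - 1) := by
  have h := Finset.sum_choose_succ_mul
    (fun k _ => if (k : ZMod 5) = r then (1 : ℕ) else 0) n
  simp only [Nat.cast_id, Nat.cast_add, Nat.cast_one, ← eq_sub_iff_add_eq] at h
  exact h

theorem residueChooseSum_two_mul_succ (n : ℕ) (d : ZMod 5) :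
    residueChooseSum (2 * (n + 1)) ((n + 1 : ℕ) + d) =
      residueChooseSum (2 * n) (n + (d + 1)) + 2 * residueChooseSum (2 * n) (n + d) +
        residueChooseSum (2 * n) (n + (d - 1)) := by
  rw [show 2 * (n + 1) = 2 * n + 1 + 1 by ring, residueChooseSum_succ, residueChooseSum_succ,
    residueChooseSum_succ]
  have h₁ : ((n + 1 : ℕ) : ZMod 5) + d = n + (d + 1) := by push_cast; ring
  have h₂ : (n : ZMod 5) + (d + 1) - 1 = n + d := by ring
  have h₃ : (n : ZMod 5) + d - 1 = n + (d - 1) := by ring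
  rw [h₁, h₂, h₃]
  ring

theorem five_mul_residueChooseSum (n : ℕ) :
    5 * residueChooseSum (2 * n) (n + 0) = 4 ^ n + 2 * lucas (2 * n) ∧
    5 * residueChooseSum (2 * n) (n + 1) + lucas (2 * n) = 4 ^ n + lucas (2 * n + 1) ∧
    5 * residueChooseSum (2 * n) (n + 2) + lucas (2 * n + 1) = 4 ^ n ∧
    5 * residueChooseSum (2 * n) (n + 3) + lucas (2 * n + 1) = 4 ^ n ∧
    5 * residueChooseSum (2 * n) (n + 4) + lucas (2 * n) = 4 ^ n + lucas (2 * n + 1) := by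
  induction n with
  | zero => decide
  | succ n ih =>
    have h₂ : lucas (2 * (n + 1)) = lucas (2 * n + 1) + lucas (2 * n) := rfl
    have h₃ : lucas (2 * (n + 1) + 1) = lucas (2 * (n + 1)) + lucas (2 * n + 1) := rfl
    have e₀ := residueChooseSum_two_mul_succ n 0
    have e₁ := residueChooseSum_two_mul_succ n 1
    have e₂ := residueChooseSum_two_mul_succ n 2
    have e₃ := residueChooseSum_two_mul_succ n 3
    have e₄ := residueChooseSum_two_mul_succ n 4
    rw [show (0 + 1 : ZMod 5) = 1 from rfl, show (0 - 1 : ZMod 5) = 4 from rfl] at e₀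
    rw [show (1 + 1 : ZMod 5) = 2 from rfl, show (1 - 1 : ZMod 5) = 0 from rfl] at e₁
    rw [show (2 + 1 : ZMod 5) = 3 from rfl, show (2 - 1 : ZMod 5) = 1 from rfl] at e₂
    rw [show (3 + 1 : ZMod 5) = 4 from rfl, show (3 - 1 : ZMod 5) = 2 from rfl] at e₃
    rw [show (4 + 1 : ZMod 5) = 0 from rfl, show (4 - 1 : ZMod 5) = 3 from rfl] at e₄
    rw [pow_succ]
    omega

/-- The multiples of `d` in `{1, …, n}` are `d * j` for `1 ≤ j ≤ n / d`. -/
theorem Finset.sum_range_ite_dvd_succ {M : Type*} [AddCommMonoid M] (n d : ℕ) (hd : 0 < d)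
    (f : ℕ → M) :
    ∑ i ∈ Finset.range n, (if d ∣ i + 1 then f (i + 1) else 0) =
      ∑ j ∈ Finset.Icc 1 (n / d), f (d * j) := by
  rw [← Finset.sum_filter]
  symm
  refine Finset.sum_bij (fun j _ => d * j - 1) ?_ ?_ ?_ ?_
  · intro j hj
    rw [Finset.mem_Icc, Nat.le_div_iff_mul_le hd] at hj
    have := Nat.mul_pos hd hj.1
    rw [Finset.mem_filter, Finset.mem_range, Nat.sub_add_cancel this]
    exact ⟨by rw [mul_comm d]; rw [mul_comm d] at this; omega, dvd_mul_right d j⟩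
  · intro i hi j hj h
    have h₁ := Nat.mul_pos hd (Finset.mem_Icc.1 hi).1
    have h₂ := Nat.mul_pos hd (Finset.mem_Icc.1 hj).1
    exact Nat.eq_of_mul_eq_mul_left hd (by omega)
  · intro i hi
    obtain ⟨hi, j, hj⟩ := Finset.mem_filter.1 hi
    refine ⟨j, ?_, by omega⟩
    rw [Finset.mem_range] at hi
    rw [Finset.mem_Icc, Nat.le_div_iff_mul_le hd, mul_comm j]
    exact ⟨Nat.pos_of_ne_zero (by rintro rfl; simp at hj), by omega⟩
  · intro j hj
    rw [Nat.sub_add_cancel (Nat.mul_pos hd (Finset.mem_Icc.1 hj).1)]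

theorem residueChooseSum_two_mul_self (n : ℕ) :
    residueChooseSum (2 * n) n =
      2 * ∑ j ∈ Finset.Icc 1 (n / 5), (2 * n).choose (n + 5 * j) + (2 * n).choose n := by
  have hsum := Finset.sum_range_ite_dvd_succ n 5 (by norm_num) (fun i => (2 * n).choose (n + i))
  have hupper : ∀ i, (((n + 1 + i : ℕ) : ZMod 5) = n) ↔ 5 ∣ i + 1 := fun i => by
    rw [← ZMod.natCast_eq_zero_iff, add_assoc, Nat.cast_add, add_eq_left, add_comm 1]
  have hlower : ∀ i < n, (((n - 1 - i : ℕ) : ZMod 5) = n) ↔ 5 ∣ i + 1 := fun i hi => by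
    rw [← ZMod.natCast_eq_zero_iff, Nat.sub_sub, add_comm 1, Nat.cast_sub (by omega),
      sub_eq_self]
  rw [residueChooseSum, show 2 * n + 1 = n + 1 + n by ring, Finset.sum_range_add,
    Finset.sum_range_succ, ← Finset.sum_range_reflect, ← hsum]
  have hl : ∀ i ∈ Finset.range n,
      ((2 * n).choose (n - 1 - i) * if ((n - 1 - i : ℕ) : ZMod 5) = n then 1 else 0) =
        if 5 ∣ i + 1 then (2 * n).choose (n + (i + 1)) else 0 := fun i hi => by
    have hi := Finset.mem_range.1 hi
    simp only [hlower i hi, mul_ite, mul_one, mul_zero]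
    rw [Nat.choose_symm_of_eq_add (show 2 * n = (n - 1 - i) + (n + (i + 1)) by omega)]
  rw [Finset.sum_congr rfl hl]
  simp only [hupper, mul_ite, mul_one, mul_zero, if_true]
  simp only [add_assoc, add_comm 1]
  ring

theorem five_mul_C_eq (n : ℕ) (hn : 1 ≤ n)
    (C : ℕ)
    (hC : C = ∑ j ∈ Finset.Icc 1 (n / 5), Nat.choose (2 * n) (n + 5 * j)) :
    5 * (C + Nat.choose (2 * n - 1) n) = 2 ^ (2 * n - 1) + lucas (2 * n) := by
  have hmain := (five_mul_residueChooseSum n).1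
  rw [add_zero, residueChooseSum_two_mul_self, ← hC] at hmain
  obtain ⟨m, rfl⟩ := Nat.exists_eq_add_of_le' hn
  have hcentral : (2 * (m + 1)).choose (m + 1) = 2 * (2 * (m + 1) - 1).choose (m + 1) := by
    rw [show 2 * (m + 1) - 1 = 2 * m + 1 by omega, show 2 * (m + 1) = 2 * m + 1 + 1 by ring,
      Nat.choose_succ_succ, Nat.choose_symm_half, ← two_mul]
  have hpow : 4 ^ (m + 1) = 2 * 2 ^ (2 * (m + 1) - 1) := by
    rw [← pow_succ', Nat.sub_add_cancel (by omega), pow_mul]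
    norm_num
  omega
end

section
/- For every natural number m ≥ 1 and every natural number n, the real number L^{(m)}_{2n+1} = Σ_{t=0}^{m−1} (2·cos((2t+1)π/(2m+1)))^{2n+1} satisfies L^{(m)}_{2n+1} = 2^{2n} − (2m+1)·Σ_{j≥0} C(2n+1, n+1+m+(2m+1)j), where the sum is over all j ≥ 0 with n+1+m+(2m+1)j ≤ 2n+1 (all further terms vanish). -/
open Real

theorem two_mul_cos_pow_eq_sum (M : ℕ) (θ : ℝ) :
    (2 * cos θ) ^ M =
      ∑ k ∈ Finset.range (M + 1), (M.choose k : ℝ) * cos ((2 * k - M) * θ) := by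
  have h : ((2 * cos θ : ℝ) : ℂ) ^ M =
      ∑ k ∈ Finset.range (M + 1),
        ((M.choose k : ℝ) : ℂ) * Complex.exp (((2 * k - M) * θ : ℝ) * Complex.I) := by
    push_cast
    rw [Complex.two_cos, add_pow]
    refine Finset.sum_congr rfl fun k hk => ?_
    have hk' : k ≤ M := Nat.lt_succ_iff.mp (Finset.mem_range.mp hk)
    rw [← Complex.exp_nat_mul, ← Complex.exp_nat_mul, ← Complex.exp_add, mul_comm]
    congr 2
    push_cast [Nat.cast_sub hk']
    ring
  have h' := congrArg Complex.re h
  rw [← Complex.ofReal_pow, Complex.ofReal_re, Complex.re_sum] at h'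
  simpa only [Complex.re_ofReal_mul, Complex.exp_ofReal_mul_I_re] using h'

theorem two_mul_cos_pow_odd_eq_sum (n : ℕ) (θ : ℝ) :
    (2 * cos θ) ^ (2 * n + 1) =
      ∑ k ∈ Finset.range (n + 1),
        ((2 * n + 1).choose (n + 1 + k) : ℝ) * (2 * cos ((2 * k + 1) * θ)) := by
  rw [two_mul_cos_pow_eq_sum, show 2 * n + 1 + 1 = (n + 1) + (n + 1) by ring,
    Finset.sum_range_add, ← Finset.sum_range_reflect, ← Finset.sum_add_distrib]
  refine Finset.sum_congr rfl fun k hk => ?_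
  have hk' : k ≤ n := Nat.lt_succ_iff.mp (Finset.mem_range.mp hk)
  have hsub : n + 1 - 1 - k = n - k := by omega
  have hchoose : (2 * n + 1).choose (n - k) = (2 * n + 1).choose (n + 1 + k) :=
    Nat.choose_symm_of_eq_add (by omega)
  have hcos : cos ((2 * ((n - k : ℕ) : ℝ) - ((2 * n + 1 : ℕ) : ℝ)) * θ) =
      cos ((2 * k + 1) * θ) := by
    rw [← cos_neg]
    congr 1
    push_cast [Nat.cast_sub hk']
    ring
  rw [hsub, hchoose, hcos]
  push_cast
  rw [show (2 * ((n : ℝ) + 1 + k) - (2 * n + 1)) * θ = (2 * k + 1) * θ by ring]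
  ring

theorem two_mul_sin_mul_sum_cos_odd (m : ℕ) (α : ℝ) :
    2 * sin α * ∑ t ∈ Finset.range m, cos ((2 * t + 1) * α) = sin (2 * m * α) := by
  induction m with
  | zero => simp
  | succ m ih =>
    rw [Finset.sum_range_succ, mul_add, ih]
    push_cast
    rw [show 2 * ((m : ℝ) + 1) * α = (2 * m + 1) * α + α by ring,
      show 2 * (m : ℝ) * α = (2 * m + 1) * α - α by ring, sin_add, sin_sub]
    ring

theorem cos_odd_mul_pi (q : ℕ) : cos ((2 * q + 1) * π) = -1 := by
  rw [show (2 * (q : ℝ) + 1) * π = π + q * (2 * π) by ring, cos_add_nat_mul_two_pi, cos_pi]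

theorem two_mul_sum_cos_odd_mul_pi_div (m k : ℕ) :
    2 * ∑ t ∈ Finset.range m, cos ((2 * k + 1) * ((2 * t + 1) * π / (2 * m + 1))) =
      1 - if 2 * m + 1 ∣ 2 * k + 1 then (2 * m + 1 : ℝ) else 0 := by
  have hN : (2 * (m : ℝ) + 1) ≠ 0 := by positivity
  split_ifs with hdvd
  · obtain ⟨q, hq⟩ := hdvd
    have hqodd : Odd q := by
      have : Odd ((2 * m + 1) * q) := hq ▸ odd_two_mul_add_one k
      exact (Nat.odd_mul.mp this).2
    obtain ⟨j, rfl⟩ := hqodd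
    have hqr : (2 * (k : ℝ) + 1) = (2 * m + 1) * (2 * j + 1) := by exact_mod_cast hq
    have hterm (t : ℕ) : cos ((2 * k + 1) * ((2 * t + 1) * π / (2 * m + 1))) = -1 := by
      rw [hqr, ← cos_odd_mul_pi (2 * j * t + j + t)]
      congr 1
      push_cast
      field_simp
      ring
    simp only [hterm, Finset.sum_const, Finset.card_range, nsmul_eq_mul]
    ring
  · set α : ℝ := (2 * k + 1) * π / (2 * m + 1) with hα
    have hNα : (2 * (m : ℝ) + 1) * α = (2 * k + 1) * π := by rw [hα]; field_simp
    have hsin : sin α ≠ 0 := by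
      intro h0
      obtain ⟨z, hz⟩ := sin_eq_zero_iff.mp h0
      rw [← hz, ← mul_assoc] at hNα
      have hr := mul_right_cancel₀ pi_ne_zero hNα
      have hint : (2 * (m : ℤ) + 1) * z = 2 * k + 1 := by exact_mod_cast hr
      refine hdvd (Int.natCast_dvd_natCast.mp ⟨z, ?_⟩)
      push_cast
      exact hint.symm
    have hsum := two_mul_sin_mul_sum_cos_odd m α
    have hsin' : sin (2 * m * α) = sin α := by
      rw [show 2 * (m : ℝ) * α = (2 * k + 1) * π - α by rw [← hNα]; ring, sin_sub,
        cos_odd_mul_pi]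
      have : sin ((2 * (k : ℝ) + 1) * π) = 0 := by
        exact_mod_cast sin_nat_mul_pi (2 * k + 1)
      rw [this]
      ring
    rw [hsin'] at hsum
    have hterm (t : ℕ) : (2 * (k : ℝ) + 1) * ((2 * t + 1) * π / (2 * m + 1)) =
        (2 * t + 1) * α := by rw [hα]; ring
    simp only [hterm]
    apply mul_left_cancel₀ hsin
    linarith

theorem sum_choose_upper_half (n : ℕ) :
    ∑ k ∈ Finset.range (n + 1), (2 * n + 1).choose (n + 1 + k) = 4 ^ n := by
  rw [← Nat.sum_range_choose_halfway, ← Finset.sum_range_reflect]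
  refine Finset.sum_congr rfl fun k hk => ?_
  have := Finset.mem_range.mp hk
  exact Nat.choose_symm_of_eq_add (by omega)

theorem sum_filter_dvd_eq_sum_filter_le {R : Type*} [AddCommMonoid R] (m n : ℕ) (f : ℕ → R) :
    ∑ k ∈ (Finset.range (n + 1)).filter (fun k => 2 * m + 1 ∣ 2 * k + 1), f (n + 1 + k) =
      ∑ j ∈ (Finset.range (n + 1)).filter
          (fun j => n + 1 + m + (2 * m + 1) * j ≤ 2 * n + 1),
        f (n + 1 + m + (2 * m + 1) * j) := by
  symm
  refine Finset.sum_bij (fun j _ => m + (2 * m + 1) * j) ?_ ?_ ?_ ?_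
  · intro j hj
    simp only [Finset.mem_filter, Finset.mem_range] at hj ⊢
    exact ⟨by omega, 2 * j + 1, by ring⟩
  · intro a _ b _ hab
    exact Nat.eq_of_mul_eq_mul_left (Nat.succ_pos (2 * m)) (Nat.add_left_cancel hab)
  · intro k hk
    simp only [Finset.mem_filter, Finset.mem_range] at hk
    obtain ⟨hkn, q, hq⟩ := hk
    have hqodd : Odd q := by
      have : Odd ((2 * m + 1) * q) := hq ▸ odd_two_mul_add_one k
      exact (Nat.odd_mul.mp this).2
    obtain ⟨j, rfl⟩ := hqodd
    have hk' : m + (2 * m + 1) * j = k := by linarith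
    have hj : j ≤ (2 * m + 1) * j := Nat.le_mul_of_pos_left j (Nat.succ_pos _)
    refine ⟨j, ?_, hk'⟩
    simp only [Finset.mem_filter, Finset.mem_range]
    omega
  · intro j _
    rw [add_assoc (n + 1)]

theorem generalized_lucas_odd_eq (m : ℕ) (hm : 1 ≤ m) (n : ℕ) :
    ∑ t ∈ Finset.range m, (2 * Real.cos ((2 * t + 1) * π / (2 * m + 1))) ^ (2 * n + 1) =
      (2 : ℝ) ^ (2 * n) -
        (2 * m + 1) *
          ∑ j ∈ (Finset.range (n + 1)).filter
              (fun j => n + 1 + m + (2 * m + 1) * j ≤ 2 * n + 1),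
            (Nat.choose (2 * n + 1) (n + 1 + m + (2 * m + 1) * j) : ℝ) := by
  have htotal : ∑ k ∈ Finset.range (n + 1), ((2 * n + 1).choose (n + 1 + k) : ℝ) =
      2 ^ (2 * n) := by
    rw [pow_mul]
    norm_num
    exact_mod_cast sum_choose_upper_half n
  rw [← sum_filter_dvd_eq_sum_filter_le m n (fun i => ((2 * n + 1).choose i : ℝ)),
    ← htotal, Finset.sum_filter, Finset.mul_sum, ← Finset.sum_sub_distrib]
  simp only [two_mul_cos_pow_odd_eq_sum]
  rw [Finset.sum_comm]
  refine Finset.sum_congr rfl fun k _ => ?_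
  rw [← Finset.mul_sum, ← Finset.mul_sum, two_mul_sum_cos_odd_mul_pi_div]
  split_ifs <;> ring
end

section
/- For every natural number n ≥ 1, the binomial coefficient C(2n−1, n−1) satisfies C(2n−1, n−1) = 1 + (1/n)·Σ_{t=1}^{⌊n/2⌋} (2·cos((2t−1)π/(2n)))^{2n}, as an equality of real numbers. -/
open Real

/-- A sum over `range n` of a sequence that is symmetric under `j ↦ n - 1 - j` and vanishes at the
fixed point of this reflection, if any, is twice the sum over the first half. -/
theorem sum_range_eq_two_mul_sum_half {R : Type*} [CommRing R] {n : ℕ} {f : ℕ → R}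
    (hsymm : ∀ j < n, f (n - 1 - j) = f j) (hmid : ∀ j, 2 * j + 1 = n → f j = 0) :
    ∑ j ∈ Finset.range n, f j = 2 * ∑ j ∈ Finset.range (n / 2), f j := by
  obtain ⟨m, rfl | rfl⟩ := Nat.even_or_odd' n
  · have hupper : ∑ x ∈ Finset.range m, f (m + x) = ∑ x ∈ Finset.range m, f x := by
      rw [← Finset.sum_range_reflect]
      refine Finset.sum_congr rfl fun x hx => ?_
      rw [Finset.mem_range] at hx
      rw [← hsymm x (by omega)]
      congr 1
      omega
    rw [two_mul m, Finset.sum_range_add, hupper, show (m + m) / 2 = m by omega, two_mul]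
  · have hupper : ∑ x ∈ Finset.range m, f (m + 1 + x) = ∑ x ∈ Finset.range m, f x := by
      rw [← Finset.sum_range_reflect]
      refine Finset.sum_congr rfl fun x hx => ?_
      rw [Finset.mem_range] at hx
      rw [← hsymm x (by omega)]
      congr 1
      omega
    rw [show 2 * m + 1 = m + 1 + m by ring, Finset.sum_range_add, hupper, Finset.sum_range_succ,
      hmid m rfl, show (m + 1 + m) / 2 = m by omega, two_mul, add_zero]

/-- The powers of a primitive root of unity `ζ ^ k` sum to `n` or `0`. -/
theorem IsPrimitiveRoot.sum_range_pow_pow {R : Type*} [CommRing R] [IsDomain R] {n : ℕ} {ζ : R}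
    (hζ : IsPrimitiveRoot ζ n) (k : ℕ) :
    ∑ j ∈ Finset.range n, (ζ ^ k) ^ j = if n ∣ k then (n : R) else 0 := by
  split_ifs with h
  · simp [(hζ.pow_eq_one_iff_dvd k).2 h]
  · have hne : ζ ^ k - 1 ≠ 0 := sub_ne_zero.2 fun h' => h ((hζ.pow_eq_one_iff_dvd k).1 h')
    refine (mul_eq_zero.1 ?_).resolve_right hne
    rw [geom_sum_mul, pow_right_comm, hζ.pow_eq_one, one_pow, sub_self]

/-- Summing `(1 + w) ^ (2 * n)` over the roots `w = ω ^ (2 * j + 1)` of `w ^ n = -1`. -/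
theorem sum_one_add_odd_pow {R : Type*} [CommRing R] [IsDomain R] {n : ℕ} (hn : 1 ≤ n) {ω : R}
    (hω : IsPrimitiveRoot (ω ^ 2) n) (hωn : ω ^ n = -1) :
    ∑ j ∈ Finset.range n, (1 + ω ^ (2 * j + 1)) ^ (2 * n) =
      n * (2 - ((2 * n).choose n : R)) := by
  have hexp : ∀ j, (1 + ω ^ (2 * j + 1)) ^ (2 * n) =
      ∑ k ∈ Finset.range (2 * n + 1), ((2 * n).choose k : R) * ω ^ k * ((ω ^ 2) ^ k) ^ j := by
    intro j
    rw [add_comm, add_pow]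
    refine Finset.sum_congr rfl fun k _ => ?_
    ring
  simp_rw [hexp]
  rw [Finset.sum_comm]
  simp_rw [← Finset.mul_sum, hω.sum_range_pow_pow, mul_ite, mul_zero]
  rw [← Finset.sum_filter]
  have hfilter : (Finset.range (2 * n + 1)).filter (n ∣ ·) = {0, n, 2 * n} := by
    ext k
    simp only [Finset.mem_filter, Finset.mem_range, Finset.mem_insert, Finset.mem_singleton]
    constructor
    · rintro ⟨hk, c, rfl⟩
      have hc : c < 3 := by
        by_contra! hc
        nlinarith
      interval_cases c
      · simp
      · simp
      · simp [mul_comm]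
    · rintro (rfl | rfl | rfl)
      · simp
      · exact ⟨by omega, dvd_rfl⟩
      · exact ⟨by omega, dvd_mul_left _ _⟩
  rw [hfilter, Finset.sum_insert (by simp; omega), Finset.sum_insert (by simp; omega),
    Finset.sum_singleton, mul_comm 2 n, pow_mul, hωn]
  simp
  ring

/-- If `w = exp (2 i x)` satisfies `w ^ n = -1`, then `(2 cos x) ^ (2 n) = -(1 + w) ^ (2 n)`. -/
theorem Complex.two_mul_cos_pow_of_exp_pow_eq_neg_one {n : ℕ} {x : ℂ}
    (h : Complex.exp (2 * x * Complex.I) ^ n = -1) :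
    (2 * Complex.cos x) ^ (2 * n) = -(1 + Complex.exp (2 * x * Complex.I)) ^ (2 * n) := by
  have hfac : 1 + Complex.exp (2 * x * Complex.I) =
      Complex.exp (x * Complex.I) * (2 * Complex.cos x) := by
    rw [Complex.two_cos, mul_add, ← Complex.exp_add, ← Complex.exp_add, add_comm]
    congr 1
    · congr 1; ring
    · rw [← Complex.exp_zero]; congr 1; ring
  have hsq : Complex.exp (x * Complex.I) ^ (2 * n) = -1 := by
    rw [pow_mul, ← Complex.exp_nat_mul, ← h]
    congr 2
    push_cast
    ring
  rw [hfac, mul_pow (Complex.exp _), hsq, neg_one_mul, neg_neg]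

theorem sum_two_mul_cos_pow (n : ℕ) (hn : 1 ≤ n) :
    ∑ j ∈ Finset.range n, (2 * Real.cos ((2 * j + 1) * π / (2 * n))) ^ (2 * n) =
      n * ((2 * n).choose n - 2 : ℝ) := by
  have hn0 : (n : ℂ) ≠ 0 := by exact_mod_cast (by omega : n ≠ 0)
  set ω : ℂ := Complex.exp (π * Complex.I / n) with hωdef
  have hωn : ω ^ n = -1 := by
    rw [hωdef, ← Complex.exp_nat_mul, mul_div_cancel₀ _ hn0, Complex.exp_pi_mul_I]
  have hω : IsPrimitiveRoot (ω ^ 2) n := by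
    convert Complex.isPrimitiveRoot_exp n (by omega) using 1
    rw [hωdef, ← Complex.exp_nat_mul]
    congr 1
    push_cast
    ring
  have hterm : ∀ j : ℕ, (2 * Complex.cos ((2 * j + 1) * π / (2 * n))) ^ (2 * n) =
      -(1 + ω ^ (2 * j + 1)) ^ (2 * n) := by
    intro j
    have hexp : Complex.exp (2 * ((2 * j + 1) * π / (2 * n)) * Complex.I) = ω ^ (2 * j + 1) := by
      rw [hωdef, ← Complex.exp_nat_mul]
      congr 1
      push_cast
      field_simp
    rw [Complex.two_mul_cos_pow_of_exp_pow_eq_neg_one, hexp]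
    rw [hexp, pow_right_comm, hωn, Odd.neg_one_pow ⟨j, rfl⟩]
  apply Complex.ofReal_injective
  push_cast
  simp_rw [hterm, Finset.sum_neg_distrib]
  rw [sum_one_add_odd_pow hn hω hωn]
  ring

theorem choose_eq_one_add_cos_sum (n : ℕ) (hn : 1 ≤ n) :
    (Nat.choose (2 * n - 1) (n - 1) : ℝ) =
      1 + (1 / n : ℝ) *
        ∑ t ∈ Finset.Icc 1 (n / 2), (2 * Real.cos ((2 * t - 1 : ℕ) * π / (2 * n))) ^ (2 * n) := by
  have hn0 : (n : ℝ) ≠ 0 := by exact_mod_cast (by omega : n ≠ 0)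
  have hshift : ∑ t ∈ Finset.Icc 1 (n / 2),
        (2 * Real.cos ((2 * t - 1 : ℕ) * π / (2 * n))) ^ (2 * n) =
      ∑ j ∈ Finset.range (n / 2), (2 * Real.cos ((2 * j + 1) * π / (2 * n))) ^ (2 * n) := by
    rw [← Finset.Ico_add_one_right_eq_Icc, Finset.sum_Ico_eq_sum_range, Nat.add_sub_cancel]
    refine Finset.sum_congr rfl fun j _ => ?_
    rw [show 2 * (1 + j) - 1 = 2 * j + 1 by omega]
    push_cast
    rfl
  have hhalf := sum_range_eq_two_mul_sum_half (n := n)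
    (f := fun j : ℕ => (2 * Real.cos ((2 * j + 1) * π / (2 * n))) ^ (2 * n))
    (by
      intro j hj
      have hang : (2 * ((n - 1 - j : ℕ) : ℝ) + 1) * π / (2 * n) =
          π - (2 * j + 1) * π / (2 * n) := by
        rw [Nat.cast_sub (by omega), Nat.cast_sub hn]
        field_simp
        push_cast
        ring
      simp only [hang, Real.cos_pi_sub, mul_neg]
      exact (even_two_mul n).neg_pow _)
    (by
      rintro j rfl
      have hang : (2 * (j : ℝ) + 1) * π / (2 * ((2 * j + 1 : ℕ) : ℝ)) = π / 2 := by
        push_cast at hn0 ⊢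
        field_simp
      simp only [hang, Real.cos_pi_div_two, mul_zero]
      exact zero_pow (by omega))
  have hchoose : ((2 * n).choose n : ℝ) = 2 * (2 * n - 1).choose (n - 1) := by
    obtain ⟨m, rfl⟩ : ∃ m, n = m + 1 := ⟨n - 1, by omega⟩
    have hp := Nat.choose_succ_succ (2 * m + 1) m
    have hs := Nat.choose_symm_half m
    rw [show 2 * (m + 1) - 1 = 2 * m + 1 by omega, Nat.add_sub_cancel]
    norm_cast
    rw [show 2 * (m + 1) = (2 * m + 1).succ by omega, hp, Nat.succ_eq_add_one, hs, ← two_mul]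
  rw [sum_two_mul_cos_pow n hn, hchoose] at hhalf
  have hsum : ∑ j ∈ Finset.range (n / 2), (2 * Real.cos ((2 * j + 1) * π / (2 * n))) ^ (2 * n) =
      n * ((2 * n - 1).choose (n - 1) - 1 : ℝ) := by
    linarith
  rw [hshift, hsum]
  field_simp
  ring
end

section
/- For every natural number n, Σ_{k=0}^{n} C(2n, n+k) · χ₈(k) = Σ_{k=0}^{n} C(n, k) · P_k, where χ₈(k) equals 1 if k ≡ 1 or 7 (mod 8), equals −1 if k ≡ 3 or 5 (mod 8), and equals 0 if k is even, and P_k denotes the k-th Pell number. -/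
/-- The Kronecker symbol `(k/8)`. -/
def chi8 (k : ℕ) : ℤ :=
  if k % 8 = 1 ∨ k % 8 = 7 then 1 else if k % 8 = 3 ∨ k % 8 = 5 then -1 else 0

/-- The Pell numbers: `P 0 = 0`, `P 1 = 1`, `P (k+2) = 2 * P (k+1) + P k`. -/
def pell : ℕ → ℕ
  | 0 => 0
  | 1 => 1
  | k + 2 => 2 * pell (k + 1) + pell k

theorem sum_range_choose_succ_mul (f : ℕ → ℤ) (m : ℕ) :
    ∑ k ∈ Finset.range (m + 2), ((m + 1).choose k : ℤ) * f k =
      ∑ k ∈ Finset.range (m + 1), (m.choose k : ℤ) * f k +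
        ∑ k ∈ Finset.range (m + 1), (m.choose k : ℤ) * f (k + 1) := by
  rw [Finset.sum_choose_succ_mul (fun i _ => f i), add_comm]

theorem chi8_eq_χ₈ (k : ℕ) : chi8 k = ZMod.χ₈ k := by
  rw [ZMod.χ₈_nat_eq_if_mod_eight, chi8]
  grind

/-- The binomial transform of the quadratic character `χ₈`, started at `a`. -/
def binomχ₈ (m : ℕ) (a : ZMod 8) : ℤ :=
  ∑ k ∈ Finset.range (m + 1), (m.choose k : ℤ) * ZMod.χ₈ (a + k)

theorem binomχ₈_succ (m : ℕ) (a : ZMod 8) :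
    binomχ₈ (m + 1) a = binomχ₈ m a + binomχ₈ m (a + 1) := by
  simp only [binomχ₈, sum_range_choose_succ_mul (fun k => ZMod.χ₈ (a + k))]
  push_cast
  simp only [add_assoc, add_comm (1 : ZMod 8)]

theorem binomχ₈_add_four (m : ℕ) (a : ZMod 8) : binomχ₈ m (a + 4) = -binomχ₈ m a := by
  have h : ∀ b : ZMod 8, ZMod.χ₈ (b + 4) = -ZMod.χ₈ b := by decide
  simp only [binomχ₈, add_right_comm a 4, h, mul_neg, Finset.sum_neg_distrib]

theorem binomχ₈_recurrence (m : ℕ) (a : ZMod 8) :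
    binomχ₈ (m + 4) a = 4 * binomχ₈ (m + 2) (a + 1) - 2 * binomχ₈ m (a + 2) := by
  have h := binomχ₈_add_four m a
  simp only [binomχ₈_succ, add_assoc]
  norm_num
  linarith

theorem binomχ₈_two_mul_neg (n : ℕ) :
    binomχ₈ (2 * n) (-n) =
      2 * ∑ k ∈ Finset.range (n + 1), ((2 * n).choose (n + k) : ℤ) * chi8 k := by
  have hneg : ∀ a : ZMod 8, ZMod.χ₈ (-a) = ZMod.χ₈ a := by decide
  have hzero : ZMod.χ₈ 0 = 0 := by decide
  have hupper : ∑ k ∈ Finset.range (n + 1),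
        ((2 * n).choose (n + k) : ℤ) * ZMod.χ₈ (-n + (n + k : ℕ)) =
      ∑ k ∈ Finset.range (n + 1), ((2 * n).choose (n + k) : ℤ) * chi8 k := by
    simp only [chi8_eq_χ₈, Nat.cast_add, neg_add_cancel_left]
  have hlower : ∑ k ∈ Finset.range n, ((2 * n).choose k : ℤ) * ZMod.χ₈ (-n + k) =
      ∑ k ∈ Finset.range (n + 1), ((2 * n).choose (n + k) : ℤ) * chi8 k := by
    rw [Finset.sum_range_succ', ← Finset.sum_range_reflect]
    simp only [chi8_eq_χ₈, Nat.cast_zero, hzero, mul_zero, add_zero]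
    refine Finset.sum_congr rfl fun k hk => ?_
    have hk : k < n := Finset.mem_range.mp hk
    obtain ⟨d, rfl⟩ : ∃ d, n = d + k + 1 := ⟨n - 1 - k, by omega⟩
    rw [show d + k + 1 - 1 - k = d by omega, ← hneg (k + 1 : ℕ),
      Nat.choose_symm_of_eq_add (show 2 * (d + k + 1) = d + (d + k + 1 + (k + 1)) by omega)]
    congr 2
    push_cast
    ring
  rw [binomχ₈, show 2 * n + 1 = n + (n + 1) by omega, Finset.sum_range_add, hupper, hlower,
    ← two_mul]

/-- The binomial transform of the Pell numbers, started at `P b`. -/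
def binomPell (n b : ℕ) : ℤ :=
  ∑ k ∈ Finset.range (n + 1), (n.choose k : ℤ) * pell (b + k)

theorem binomPell_succ (n b : ℕ) :
    binomPell (n + 1) b = binomPell n b + binomPell n (b + 1) := by
  simp only [binomPell, sum_range_choose_succ_mul (fun k => (pell (b + k) : ℤ))]
  simp only [add_assoc, add_comm 1]

theorem binomPell_add_two (n b : ℕ) :
    binomPell n (b + 2) = 2 * binomPell n (b + 1) + binomPell n b := by
  simp only [binomPell, Finset.mul_sum, ← Finset.sum_add_distrib]
  refine Finset.sum_congr rfl fun k _ => ?_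
  rw [show b + 2 + k = b + k + 2 by omega, show b + 1 + k = b + k + 1 by omega, pell]
  push_cast
  ring

theorem binomPell_recurrence (n b : ℕ) :
    binomPell (n + 2) b = 4 * binomPell (n + 1) b - 2 * binomPell n b := by
  simp only [binomPell_succ, add_assoc, Nat.reduceAdd, binomPell_add_two]
  ring

theorem binomχ₈_eq_two_mul_binomPell (n : ℕ) :
    binomχ₈ (2 * n) (-n) = 2 * binomPell n 0 := by
  induction n using Nat.twoStepInduction with
  | zero => decide
  | one => decide
  | more n ih₀ ih₁ =>
    have h := binomχ₈_recurrence (2 * n) (-(n + 2 : ℕ))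
    rw [show (-(n + 2 : ℕ) + 1 : ZMod 8) = -(n + 1 : ℕ) by push_cast; ring,
      show (-(n + 2 : ℕ) + 2 : ZMod 8) = -n by push_cast; ring] at h
    rw [show 2 * (n + 2) = 2 * n + 4 by ring, h, show 2 * n + 2 = 2 * (n + 1) by ring, ih₀, ih₁,
      binomPell_recurrence]
    ring

theorem sum_choose_chi8_eq_sum_choose_pell (n : ℕ) :
    ∑ k ∈ Finset.range (n + 1), (Nat.choose (2 * n) (n + k) : ℤ) * chi8 k =
      ∑ k ∈ Finset.range (n + 1), (Nat.choose n k : ℤ) * pell k := by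
  have h := (binomχ₈_two_mul_neg n).symm.trans (binomχ₈_eq_two_mul_binomPell n)
  simpa [binomPell] using h
end

section
/- For every natural number n, Σ_{k=1}^{n} (−1)^{k+1} · C(2n, n+k) · (k/5) = Σ_{k=0}^{n} C(n, k) · F_{2k}, where (k/5) denotes the Legendre symbol modulo 5 and F_m denotes the Fibonacci numbers. -/
/-- The Legendre symbol modulo 5. -/
def leg5 (k : ℕ) : ℤ :=
  if k % 5 = 0 then 0 else if k % 5 = 1 ∨ k % 5 = 4 then 1 else -1

/-- The even, `10`-periodic function on `ℤ` whose value at `k : ℕ` is `(-1) ^ (k + 1) * leg5 k`. -/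
def altLeg5 (k : ℤ) : ℤ :=
  if k % 5 = 0 then 0
  else if k % 10 = 1 ∨ k % 10 = 2 ∨ k % 10 = 8 ∨ k % 10 = 9 then 1 else -1

theorem altLeg5_natCast (k : ℕ) : altLeg5 k = (-1) ^ (k + 1) * leg5 k := by
  have h : k % 10 < 10 := Nat.mod_lt _ (by norm_num)
  have h5 : k % 5 = k % 10 % 5 := by omega
  have h2 : (k + 1) % 2 = (k % 10 + 1) % 2 := by omega
  have h10 : (k : ℤ) % 10 = (k % 10 : ℕ) := by omega
  have h5' : (k : ℤ) % 5 = (k % 10 % 5 : ℕ) := by omega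
  rw [neg_one_pow_eq_pow_mod_two, h2]
  unfold altLeg5 leg5
  rw [h5, h10, h5']
  generalize k % 10 = r at h
  decide +revert

theorem altLeg5_neg (k : ℤ) : altLeg5 (-k) = altLeg5 k := by
  unfold altLeg5
  split_ifs <;> omega

theorem altLeg5_recurrence (k : ℤ) :
    altLeg5 (k - 2) - altLeg5 (k - 1) + altLeg5 k - altLeg5 (k + 1) + altLeg5 (k + 2) = 0 := by
  have h : k % 10 = 0 ∨ k % 10 = 1 ∨ k % 10 = 2 ∨ k % 10 = 3 ∨ k % 10 = 4 ∨ k % 10 = 5 ∨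
    k % 10 = 6 ∨ k % 10 = 7 ∨ k % 10 = 8 ∨ k % 10 = 9 := by omega
  have h5 : k % 5 = k % 10 % 5 := by omega
  unfold altLeg5
  rcases h with h | h | h | h | h | h | h | h | h | h <;>
    simp [Int.add_emod, Int.sub_emod, h, h5]

theorem sum_choose_succ_mul_eq (m : ℕ) (f : ℕ → ℤ) :
    ∑ j ∈ Finset.range (m + 2), ((m + 1).choose j : ℤ) * f j =
      ∑ j ∈ Finset.range (m + 1), (m.choose j : ℤ) * (f j + f (j + 1)) := by
  rw [Finset.sum_choose_succ_mul (fun i _ => f i) m, ← Finset.sum_add_distrib]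
  exact Finset.sum_congr rfl fun j _ => by ring

/-- The sum of `f` over `[-n, n]`, weighted by the central row `C(2n, n + k)`. -/
def centralSum (n : ℕ) (f : ℤ → ℤ) : ℤ :=
  ∑ j ∈ Finset.range (2 * n + 1), ((2 * n).choose j : ℤ) * f (j - n)

theorem centralSum_succ (n : ℕ) (f : ℤ → ℤ) :
    centralSum (n + 1) f = centralSum n fun k => f (k - 1) + 2 * f k + f (k + 1) := by
  unfold centralSum
  rw [show 2 * (n + 1) = 2 * n + 1 + 1 by ring,
    sum_choose_succ_mul_eq (2 * n + 1) fun j => f (j - (n + 1 : ℕ)),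
    sum_choose_succ_mul_eq (2 * n)
      fun j => f (j - (n + 1 : ℕ)) + f ((j + 1 : ℕ) - (n + 1 : ℕ))]
  refine Finset.sum_congr rfl fun j _ => ?_
  push_cast
  rw [show (j : ℤ) - (n + 1) = j - n - 1 by ring, show (j : ℤ) + 1 - (n + 1) = j - n by ring,
    show (j : ℤ) + 1 + 1 - (n + 1) = j - n + 1 by ring]
  ring

theorem centralSum_altLeg5_add_two (n : ℕ) :
    centralSum (n + 2) altLeg5 =
      5 * centralSum (n + 1) altLeg5 - 5 * centralSum n altLeg5 := by
  rw [centralSum_succ, centralSum_succ, centralSum_succ]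
  unfold centralSum
  rw [Finset.mul_sum, Finset.mul_sum, ← Finset.sum_sub_distrib]
  refine Finset.sum_congr rfl fun j _ => ?_
  have h := altLeg5_recurrence (j - n)
  ring_nf at h ⊢
  linear_combination ((n * 2).choose j : ℤ) * h

theorem centralSum_of_even (n : ℕ) (f : ℤ → ℤ) (hf : ∀ k, f (-k) = f k) (h0 : f 0 = 0) :
    centralSum n f = 2 * ∑ k ∈ Finset.Icc 1 n, ((2 * n).choose (n + k) : ℤ) * f k := by
  have hIcc : Finset.Icc 1 n = Finset.Ico 1 (n + 1) := by
    ext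
    simp
  rw [hIcc, Finset.sum_Ico_eq_sum_range]
  unfold centralSum
  rw [show 2 * n + 1 = n + (n + 1) by ring, Finset.sum_range_add, Finset.sum_range_succ',
    ← Finset.sum_range_reflect, two_mul (Finset.sum _ _)]
  simp only [Nat.add_sub_cancel, add_zero, sub_self, h0, mul_zero]
  congr 1
  · refine Finset.sum_congr rfl fun j hj => ?_
    have hj := Finset.mem_range.1 hj
    rw [← Nat.choose_symm (show n + (1 + j) ≤ 2 * n by omega), ← hf]
    congr 3 <;> omega
  · refine Finset.sum_congr rfl fun j _ => ?_
    rw [add_comm 1 j]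
    congr 2
    push_cast
    ring

theorem sum_choose_fib_add_two (n : ℕ) :
    ∑ k ∈ Finset.range (n + 3), ((n + 2).choose k : ℤ) * Nat.fib (2 * k) =
      5 * ∑ k ∈ Finset.range (n + 2), ((n + 1).choose k : ℤ) * Nat.fib (2 * k) -
        5 * ∑ k ∈ Finset.range (n + 1), (n.choose k : ℤ) * Nat.fib (2 * k) := by
  rw [sum_choose_succ_mul_eq (n + 1) fun k => (Nat.fib (2 * k) : ℤ),
    sum_choose_succ_mul_eq n fun k => (Nat.fib (2 * k) + Nat.fib (2 * (k + 1)) : ℤ),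
    sum_choose_succ_mul_eq n fun k => (Nat.fib (2 * k) : ℤ),
    Finset.mul_sum, Finset.mul_sum, ← Finset.sum_sub_distrib]
  refine Finset.sum_congr rfl fun k _ => ?_
  have h2 : Nat.fib (2 * (k + 1)) = Nat.fib (2 * k) + Nat.fib (2 * k + 1) := Nat.fib_add_two
  have h3 : Nat.fib (2 * k + 3) = Nat.fib (2 * k + 1) + Nat.fib (2 * (k + 1)) := Nat.fib_add_two
  have h4 : Nat.fib (2 * (k + 1 + 1)) = Nat.fib (2 * (k + 1)) + Nat.fib (2 * k + 3) :=
    Nat.fib_add_two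
  rw [h4, h3, h2]
  push_cast
  ring

theorem centralSum_altLeg5_eq (n : ℕ) :
    centralSum n altLeg5 =
      2 * ∑ k ∈ Finset.range (n + 1), (n.choose k : ℤ) * Nat.fib (2 * k) := by
  induction n using Nat.twoStepInduction with
  | zero => decide
  | one => decide
  | more n ih₀ ih₁ =>
    rw [centralSum_altLeg5_add_two, ih₀, ih₁, sum_choose_fib_add_two]
    ring

theorem alt_sum_choose_leg5_eq_sum_choose_fib (n : ℕ) :
    ∑ k ∈ Finset.Icc 1 n, (-1 : ℤ) ^ (k + 1) * Nat.choose (2 * n) (n + k) * leg5 k =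
      ∑ k ∈ Finset.range (n + 1), (Nat.choose n k : ℤ) * Nat.fib (2 * k) := by
  have h := centralSum_altLeg5_eq n
  rw [centralSum_of_even n altLeg5 altLeg5_neg rfl] at h
  rw [← mul_left_cancel₀ two_ne_zero h]
  refine Finset.sum_congr rfl fun k _ => ?_
  rw [altLeg5_natCast]
  ring
end

section
/- Let S be the integer sequence defined by S_0 = 1, S_1 = 2, S_2 = 6, and S_{n+3} = 6·S_{n+2} − 9·S_{n+1} + S_n for all n ≥ 0. Then for every natural number n, S_n = C(2n, n) − Σ_{j=1}^{⌊n/3⌋} C(2n, n+3j) + 3·Σ_{j=1}^{⌊n/9⌋} C(2n, n+9j). -/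
/-- The sequence OEIS A094831: `S 0 = 1`, `S 1 = 2`, `S 2 = 6`,
`S (n+3) = 6 * S (n+2) - 9 * S (n+1) + S n`. -/
def S : ℕ → ℤ
  | 0 => 1
  | 1 => 2
  | 2 => 6
  | n + 3 => 6 * S (n + 2) - 9 * S (n + 1) + S n

open Finset in
theorem sum_range_mul_choose_succ {R : Type*} [CommRing R] (g : ℕ → R) (m : ℕ) :
    ∑ i ∈ range (m + 2), g i * ((m + 1).choose i : R) =
      ∑ i ∈ range (m + 1), (g i + g (i + 1)) * (m.choose i : R) := by
  rw [sum_range_succ']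
  simp only [Nat.choose_succ_succ, Nat.cast_add, mul_add, add_mul, sum_add_distrib]
  have h : ∑ i ∈ range (m + 1), g i * (m.choose i : R) =
      ∑ i ∈ range (m + 1), g (i + 1) * (m.choose (i + 1) : R) + g 0 := by
    have h₁ := sum_range_succ' (fun i => g i * (m.choose i : R)) (m + 1)
    rw [sum_range_succ] at h₁
    simpa using h₁
  rw [h]
  simp
  ring

/-- The sum of `u k * C(2n, n + k)` over all integers `k` with `-n ≤ k ≤ n`. -/
def centralChooseSum (u : ℤ → ℤ) (n : ℕ) : ℤ :=
  ∑ i ∈ Finset.range (2 * n + 1), u (i - n) * ((2 * n).choose i : ℤ)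

theorem centralChooseSum_succ (u : ℤ → ℤ) (n : ℕ) :
    centralChooseSum u (n + 1) =
      centralChooseSum (fun k => u (k - 1) + 2 * u k + u (k + 1)) n := by
  unfold centralChooseSum
  rw [show 2 * (n + 1) = 2 * n + 1 + 1 by ring,
    sum_range_mul_choose_succ (fun i => u ((i : ℤ) - ((n + 1 : ℕ) : ℤ))),
    sum_range_mul_choose_succ (fun i => u ((i : ℤ) - ((n + 1 : ℕ) : ℤ)) +
      u (((i + 1 : ℕ) : ℤ) - ((n + 1 : ℕ) : ℤ)))]
  refine Finset.sum_congr rfl fun i _ => ?_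
  push_cast
  rw [show (i : ℤ) - (n + 1) = i - n - 1 by ring, show (i : ℤ) + 1 - (n + 1) = i - n by ring,
    show (i : ℤ) + 1 + 1 - (n + 1) = i - n + 1 by ring]
  ring

open Finset in
theorem centralChooseSum_of_even {u : ℤ → ℤ} (hu : ∀ k, u (-k) = u k) (n : ℕ) :
    centralChooseSum u n = u 0 * ((2 * n).choose n : ℤ) +
      2 * ∑ k ∈ Icc 1 n, u k * ((2 * n).choose (n + k) : ℤ) := by
  have hright : ∑ k ∈ Icc 1 n, u k * ((2 * n).choose (n + k) : ℤ) =
      ∑ j ∈ range n, u ((j + 1 : ℕ) : ℤ) * ((2 * n).choose (n + (j + 1)) : ℤ) := by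
    rw [range_eq_Ico, sum_Ico_add' (fun k : ℕ => u k * ((2 * n).choose (n + k) : ℤ)) 0 n 1]
    rfl
  have hleft : ∑ i ∈ range n, u ((i : ℤ) - n) * ((2 * n).choose i : ℤ) =
      ∑ j ∈ range n, u ((j + 1 : ℕ) : ℤ) * ((2 * n).choose (n + (j + 1)) : ℤ) := by
    rw [← sum_range_reflect]
    refine sum_congr rfl fun j hj => ?_
    rw [mem_range] at hj
    rw [← hu, ← Nat.choose_symm_of_eq_add (show 2 * n = (n + (j + 1)) + (n - 1 - j) by omega)]
    congr 2
    omega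
  rw [centralChooseSum, show 2 * n + 1 = n + (n + 1) by ring, sum_range_add, sum_range_succ',
    hleft, hright]
  simp only [Nat.cast_add, add_sub_cancel_left, add_zero, sub_self]
  ring

open Finset in
theorem sum_Icc_ite_dvd {M : Type*} [AddCommMonoid M] {d : ℕ} (hd : 0 < d) (n : ℕ) (g : ℕ → M) :
    ∑ k ∈ Icc 1 n, (if d ∣ k then g k else 0) = ∑ j ∈ Icc 1 (n / d), g (d * j) := by
  rw [← sum_filter]
  symm
  refine sum_bij (fun j _ => d * j) ?_ ?_ ?_ ?_
  · intro j hj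
    rw [mem_Icc, Nat.le_div_iff_mul_le hd] at hj
    rw [mem_filter, mem_Icc]
    exact ⟨⟨Nat.mul_pos hd hj.1, by rw [mul_comm]; exact hj.2⟩, dvd_mul_right _ _⟩
  · intro a _ b _ h
    exact Nat.eq_of_mul_eq_mul_left hd h
  · intro k hk
    rw [mem_filter, mem_Icc] at hk
    obtain ⟨⟨h₁, h₂⟩, j, rfl⟩ := hk
    refine ⟨j, ?_, rfl⟩
    rw [mem_Icc, Nat.le_div_iff_mul_le hd, mul_comm j]
    exact ⟨Nat.pos_of_mul_pos_left h₁, h₂⟩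
  · intros
    rfl

/-- The 9-periodic weight `3 · [9 ∣ k] - [3 ∣ k]`: a third of the sum of the `k`-th powers of
the primitive ninth roots of unity. -/
def ninthWeight (k : ℤ) : ℤ :=
  3 * (if 9 ∣ k then 1 else 0) - if 3 ∣ k then 1 else 0

theorem ninthWeight_neg (k : ℤ) : ninthWeight (-k) = ninthWeight k := by
  simp [ninthWeight]

theorem ninthWeight_sub_three_add_add_three (k : ℤ) :
    ninthWeight (k - 3) + ninthWeight k + ninthWeight (k + 3) = 0 := by
  unfold ninthWeight
  split_ifs <;> omega

theorem centralChooseSum_ninthWeight_rec (n : ℕ) :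
    centralChooseSum ninthWeight (n + 3) = 6 * centralChooseSum ninthWeight (n + 2) -
      9 * centralChooseSum ninthWeight (n + 1) + centralChooseSum ninthWeight n := by
  simp only [centralChooseSum_succ]
  unfold centralChooseSum
  simp only [Finset.mul_sum, ← Finset.sum_sub_distrib, ← Finset.sum_add_distrib]
  refine Finset.sum_congr rfl fun i _ => ?_
  have h := ninthWeight_sub_three_add_add_three ((i : ℤ) - n)
  generalize (i : ℤ) - n = k at *
  rw [show k - 3 = k - 1 - 1 - 1 by ring, show k + 3 = k + 1 + 1 + 1 by ring] at h
  simp only [sub_add_cancel, add_sub_cancel_right]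
  linear_combination ((2 * n).choose i : ℤ) * h

theorem two_mul_S_eq (n : ℕ) : 2 * S n = centralChooseSum ninthWeight n := by
  induction n using S.induct with
  | case1 => decide
  | case2 => decide
  | case3 => decide
  | case4 n ih₂ ih₁ ih₀ =>
    rw [centralChooseSum_ninthWeight_rec, S]
    linarith

theorem S_eq_choose_sum (n : ℕ) :
    S n =
      (Nat.choose (2 * n) n : ℤ) -
        (∑ j ∈ Finset.Icc 1 (n / 3), (Nat.choose (2 * n) (n + 3 * j) : ℤ)) +
        3 * ∑ j ∈ Finset.Icc 1 (n / 9), (Nat.choose (2 * n) (n + 9 * j) : ℤ) := by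
  have h := two_mul_S_eq n
  rw [centralChooseSum_of_even ninthWeight_neg] at h
  rw [← sum_Icc_ite_dvd (by norm_num) n fun k => ((2 * n).choose (n + k) : ℤ),
    ← sum_Icc_ite_dvd (by norm_num) n fun k => ((2 * n).choose (n + k) : ℤ)]
  have hsum : ∑ k ∈ Finset.Icc 1 n, ninthWeight k * ((2 * n).choose (n + k) : ℤ) =
      3 * (∑ k ∈ Finset.Icc 1 n, if 9 ∣ k then ((2 * n).choose (n + k) : ℤ) else 0) -
        ∑ k ∈ Finset.Icc 1 n, if 3 ∣ k then ((2 * n).choose (n + k) : ℤ) else 0 := by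
    rw [Finset.mul_sum, ← Finset.sum_sub_distrib]
    refine Finset.sum_congr rfl fun k _ => ?_
    have h₉ : (9 : ℤ) ∣ k ↔ 9 ∣ k := by omega
    have h₃ : (3 : ℤ) ∣ k ↔ 3 ∣ k := by omega
    simp only [ninthWeight, h₉, h₃]
    split_ifs <;> ring
  rw [hsum, show ninthWeight 0 = 2 by decide] at h
  linarith
end
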